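/- Let −1 ≤ a < b be real numbers and let F be the cumulative distribution function of the uniform distribution on [a,b], i.e. F(ε) = 0 for ε < a, F(ε) = (ε−a)/(b−a) for a ≤ ε ≤ b, and F(ε) = 1 for ε > b. Define h(ε) := (1+ε)·(1 − F(ε)) for ε ∈ [−1, ∞). Then h attains its maximum over [−1, ∞) at ε* = (1/2)·max(2a, b−1); that is, h(ε) ≤ h((1/2)·max(2a, b−1)) for all ε ≥ −1. -/

import Mathlib

/-- Let `−1 ≤ a < b` and let `F` be the cdf of the uniform distribution
on `[a,b]`.  Then `h(ε) := (1+ε)(1 − F ε)` attains its maximum over `[−1,∞)` at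
`ε* = (1/2)·max (2a) (b−1)`. -/
theorem uniform_cdf_optimal_pricing (a b : ℝ) (ha : -1 ≤ a) (hab : a < b)
    (F : ℝ → ℝ)
    (hF_lt : ∀ ε : ℝ, ε < a → F ε = 0)
    (hF_mid : ∀ ε : ℝ, a ≤ ε → ε ≤ b → F ε = (ε - a) / (b - a))
    (hF_gt : ∀ ε : ℝ, b < ε → F ε = 1) :
    ∀ ε : ℝ, -1 ≤ ε →
      (1 + ε) * (1 - F ε) ≤
        (1 + (1 / 2) * max (2 * a) (b - 1)) * (1 - F ((1 / 2) * max (2 * a) (b - 1))) := by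
  intro x hx
  have hd : 0 < b - a := sub_pos.mpr hab
  obtain ⟨m, hm⟩ : ∃ m : ℝ, m = (1 / 2) * max (2 * a) (b - 1) := ⟨_, rfl⟩
  rw [← hm]
  have h1 := le_max_left (2 * a) (b - 1)
  have ham : a ≤ m := by linarith
  have hmb : m ≤ b := by
    rcases max_cases (2 * a) (b - 1) with h | h <;> linarith [h.1]
  have mid : ∀ y : ℝ, a ≤ y → y ≤ b → (1 + y) * (1 - F y) = (1 + y) * (b - y) / (b - a) := by
    intro y h1 h2
    rw [hF_mid y h1 h2]
    field_simp
    ring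
  have key : ∀ y : ℝ, a ≤ y → (1 + y) * (b - y) / (b - a) ≤ (1 + m) * (b - m) / (b - a) := by
    intro y hy
    apply div_le_div_of_nonneg_right _ hd.le
    rcases max_cases (2 * a) (b - 1) with ⟨h, h'⟩ | ⟨h, h'⟩
    · have : m = a := by linarith
      subst this
      nlinarith [mul_nonneg (sub_nonneg.mpr hy) (by linarith : 0 ≤ m + y - (b - 1))]
    · have : b = 2 * m + 1 := by linarith
      subst this
      nlinarith [sq_nonneg (m - y)]
  rw [mid m ham hmb]
  rcases lt_or_ge x a with h | h
  · rw [hF_lt x h]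
    have := key a le_rfl
    rw [mul_div_assoc, div_self hd.ne'] at this
    linarith
  · rcases le_or_gt x b with h2 | h2
    · rw [mid x h h2]
      exact key x h
    · rw [hF_gt x h2]
      have := key b hab.le
      simp at this
      simpa using this
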